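/- For all integers l and s with l ≥ 3 and 1 < s < l, the integer l+2 divides 3 · C(l+2, s+2) · C(l+2, s−1), where C(·,·) denotes the binomial coefficient. -/

import Mathlib

/-- `n + 1` divides `C(n + 1, k + 1) * (k + 1)`. -/
theorem succ_dvd_choose_mul_succ (n k : ℕ) :
    (n + 1) ∣ Nat.choose (n + 1) (k + 1) * (k + 1) :=
  ⟨_, (Nat.add_one_mul_choose_eq n k).symm⟩

/-- For all integers `l, s` with `l ≥ 3` and `1 < s < l`, the integer `l+2`
divides `3 * C(l+2, s+2) * C(l+2, s-1)`. -/
theorem grassmannian_twisted_one_forms_dim_dvd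
    (l s : ℕ) (hl : 3 ≤ l) (hs1 : 1 < s) (hs2 : s < l) :
    (l + 2) ∣ 3 * Nat.choose (l + 2) (s + 2) * Nat.choose (l + 2) (s - 1) := by
  obtain ⟨t, rfl⟩ := Nat.exists_eq_add_of_le' hs1
  have ha : (l + 2) ∣ Nat.choose (l + 2) (t + 4) * (t + 4) :=
    succ_dvd_choose_mul_succ (l + 1) (t + 3)
  have hb : (l + 2) ∣ Nat.choose (l + 2) (t + 1) * (t + 1) :=
    succ_dvd_choose_mul_succ (l + 1) t
  change (l + 2) ∣ 3 * Nat.choose (l + 2) (t + 4) * Nat.choose (l + 2) (t + 1)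
  generalize Nat.choose (l + 2) (t + 4) = A at *
  generalize Nat.choose (l + 2) (t + 1) = B at *
  refine (Nat.dvd_add_right (hb.mul_left A)).mp ?_
  have h : A * (B * (t + 1)) + 3 * A * B = B * (A * (t + 4)) := by ring
  exact h ▸ ha.mul_left B
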